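/- Let ρ be a d×d density matrix with orthonormal eigenbasis ψ_0,…,ψ_{d−1} and corresponding eigenvalues λ_0,…,λ_{d−1}, let D be a Lindblad dissipator built from matrices L_1,…,L_m, and let γ > 0. Define H = iγ Σ_{l,l' : λ_l ≠ λ_{l'}} (⟨ψ_l, D(ρ)ψ_{l'}⟩/(λ_l − λ_{l'})) ψ_l ψ_{l'}†. Then H is Hermitian, and if ⟨ψ_l, D(ρ)ψ_{l'}⟩ = 0 for all pairs l, l' with λ_l = λ_{l'}, then −i(Hρ − ρH) + γ D(ρ) = 0, i.e., H stabilizes ρ. -/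

import Mathlib

open Matrix
open scoped ComplexOrder

/-- The rank-one projections onto an orthonormal basis sum to the identity. -/
theorem sum_vecMulVec_star_eq_one {n : Type*} [Fintype n] [DecidableEq n]
    (ψ : n → (n → ℂ)) (hON : ∀ l l', star (ψ l) ⬝ᵥ ψ l' = if l = l' then 1 else 0) :
    ∑ l, vecMulVec (ψ l) (star (ψ l)) = 1 := by
  have hU : (of ψ)ᵀᴴ * (of ψ)ᵀ = 1 := by
    ext l l'
    simpa [Matrix.mul_apply, one_apply, dotProduct] using hON l l'
  rw [mul_eq_one_comm] at hU
  rw [← hU]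
  ext i j
  simp [Matrix.mul_apply, Matrix.sum_apply, vecMulVec_apply]

/-- Expansion of a matrix in the rank-one matrices of an orthonormal basis. -/
theorem eq_sum_smul_vecMulVec_star {n : Type*} [Fintype n] [DecidableEq n]
    (ψ : n → (n → ℂ)) (hON : ∀ l l', star (ψ l) ⬝ᵥ ψ l' = if l = l' then 1 else 0)
    (A : Matrix n n ℂ) :
    A = ∑ l, ∑ l', (star (ψ l) ⬝ᵥ (A *ᵥ ψ l')) • vecMulVec (ψ l) (star (ψ l')) := by
  conv_lhs => rw [← one_mul A, ← mul_one (1 * A), ← sum_vecMulVec_star_eq_one ψ hON]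
  simp only [Finset.sum_mul, Finset.mul_sum]
  rw [Finset.sum_comm]
  refine Finset.sum_congr rfl fun l _ => Finset.sum_congr rfl fun l' _ => ?_
  rw [vecMulVec_mul, vecMulVec_mul_vecMulVec, dotProduct_mulVec, vecMulVec_smul]

theorem conjTranspose_vecMulVec_star {n : Type*} (v w : n → ℂ) :
    (vecMulVec v (star w))ᴴ = vecMulVec w (star v) := by
  rw [conjTranspose_vecMulVec, star_star]

/-- The sesquilinear form of a Hermitian matrix is conjugate symmetric. -/
theorem Matrix.IsHermitian.star_dotProduct_mulVec {n : Type*} [Fintype n]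
    {A : Matrix n n ℂ} (hA : A.IsHermitian) (v w : n → ℂ) :
    star (star v ⬝ᵥ (A *ᵥ w)) = star w ⬝ᵥ (A *ᵥ v) := by
  rw [← star_dotProduct_star, star_star, star_mulVec, hA.eq, ← dotProduct_mulVec]

/-- A Lindblad dissipator maps Hermitian matrices to Hermitian matrices. -/
theorem isHermitian_dissipator {n ι : Type*} [Fintype n] [Fintype ι]
    (L : ι → Matrix n n ℂ) {M : Matrix n n ℂ} (hM : M.IsHermitian) :
    (∑ j, (L j * M * (L j)ᴴ
      - (1/2 : ℂ) • ((L j)ᴴ * L j * M + M * ((L j)ᴴ * L j)))).IsHermitian := by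
  rw [IsHermitian, conjTranspose_sum]
  refine Finset.sum_congr rfl fun j _ => ?_
  simp [conjTranspose_sub, conjTranspose_smul, hM.eq, Matrix.mul_assoc, add_comm]

theorem stmt_1 {d m : ℕ}
    (ρ : Matrix (Fin d) (Fin d) ℂ)
    (hPSD : ρ.PosSemidef) (hTr : ρ.trace = 1)
    (ψ : Fin d → (Fin d → ℂ)) (lam : Fin d → ℝ)
    (hON : ∀ l l', star (ψ l) ⬝ᵥ ψ l' = if l = l' then 1 else 0)
    (hEig : ∀ l, ρ *ᵥ ψ l = (lam l : ℂ) • ψ l)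
    (L : Fin m → Matrix (Fin d) (Fin d) ℂ)
    (D : Matrix (Fin d) (Fin d) ℂ → Matrix (Fin d) (Fin d) ℂ)
    (hD : ∀ M, D M = ∑ j, (L j * M * (L j)ᴴ
      - (1/2 : ℂ) • ((L j)ᴴ * L j * M + M * ((L j)ᴴ * L j))))
    (γ : ℝ) (hγ : 0 < γ)
    (H : Matrix (Fin d) (Fin d) ℂ)
    (hH : H = (Complex.I * (γ : ℂ)) • ∑ l, ∑ l',
      if lam l ≠ lam l' then
        ((star (ψ l) ⬝ᵥ (D ρ *ᵥ ψ l')) / ((lam l : ℂ) - (lam l' : ℂ))) •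
          Matrix.vecMulVec (ψ l) (star (ψ l'))
      else 0) :
    H.IsHermitian ∧
      ((∀ l l', lam l = lam l' → star (ψ l) ⬝ᵥ (D ρ *ᵥ ψ l') = 0) →
        (-Complex.I) • (H * ρ - ρ * H) + (γ : ℂ) • D ρ = 0) := by
  have hDH : (D ρ).IsHermitian := hD ρ ▸ isHermitian_dissipator L hPSD.isHermitian
  constructor
  · rw [hH, IsHermitian, conjTranspose_smul, conjTranspose_sum, Finset.smul_sum, Finset.smul_sum]
    simp only [conjTranspose_sum, Finset.smul_sum]
    rw [Finset.sum_comm]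
    refine Finset.sum_congr rfl fun l _ => Finset.sum_congr rfl fun l' _ => ?_
    by_cases h : lam l = lam l'
    · simp [h]
    · rw [if_pos h, if_pos (Ne.symm h), conjTranspose_smul, conjTranspose_vecMulVec_star,
        smul_smul, smul_smul, star_div₀, hDH.star_dotProduct_mulVec]
      congr 1
      have h₁ : (lam l : ℂ) - lam l' ≠ 0 := sub_ne_zero.2 (by exact_mod_cast h)
      have h₂ : (lam l' : ℂ) - lam l ≠ 0 := sub_ne_zero.2 (by exact_mod_cast Ne.symm h)
      simp only [star_mul', star_sub, Complex.star_def, Complex.conj_I, Complex.conj_ofReal]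
      field_simp
      ring
  · intro h0
    have hR (l) : star (ψ l) ᵥ* ρ = (lam l : ℂ) • star (ψ l) := by
      have := congrArg star (hEig l)
      rwa [star_mulVec, hPSD.isHermitian.eq, star_smul, Complex.star_def,
        Complex.conj_ofReal] at this
    conv_lhs => rw [eq_sum_smul_vecMulVec_star ψ hON (D ρ)]
    rw [hH, smul_mul_assoc, mul_smul_comm, ← smul_sub, smul_smul]
    simp only [Finset.sum_mul, Finset.mul_sum, ← Finset.sum_sub_distrib, Finset.smul_sum,
      ← Finset.sum_add_distrib]
    refine Finset.sum_eq_zero fun l _ => Finset.sum_eq_zero fun l' _ => ?_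
    by_cases h : lam l = lam l'
    · simp [h, h0 l l' h]
    · have h₁ : (lam l : ℂ) - lam l' ≠ 0 := sub_ne_zero.2 (by exact_mod_cast h)
      rw [if_pos h, smul_mul_assoc, mul_smul_comm, vecMulVec_mul, mul_vecMulVec, hR, hEig,
        vecMulVec_smul, smul_vecMulVec, smul_smul, smul_smul, ← sub_smul, smul_smul, smul_smul,
        ← add_smul]
      convert zero_smul ℂ _
      field_simp
      linear_combination (γ : ℂ) * (star (ψ l) ⬝ᵥ (D ρ *ᵥ ψ l')) * (lam l - lam l') * Complex.I_sq
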